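/- arXiv:1106.4117 — 2 statements merged into one kernel-verified Lean document; each statement's English description precedes it below -/
import Mathlib

section
/- Let k be a field of characteristic p > 2 and A an associative unital k-algebra containing elements g, a, b with ag = ga, bg = ga + gb and ba = ab + (1/2)a². Then for every m with 1 ≤ m ≤ p − 1 there exist scalars β_{m,0}, β_{m,1}, …, β_{m,m} ∈ k such that g·b^m = Σ_{i=0}^{m} β_{m,i}·b^{m−i}·g·a^{i}, with β_{m,0} = 1, β_{m,1} = −m and (when m ≥ 2) β_{m,2} = (3/4)m(m−1). -/
/-- The coefficients `β_{m,i}`. -/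
noncomputable def betaCoeff (k : Type*) [Field k] : ℕ → ℕ → k
  | 0, 0 => 1
  | 0, _ + 1 => 0
  | m + 1, 0 => betaCoeff k m 0
  | m + 1, i + 1 => betaCoeff k m (i + 1) - (1 + (i : k) / 2) * betaCoeff k m i

theorem betaCoeff_vanish (k : Type*) [Field k] (m : ℕ) :
    ∀ i, m < i → betaCoeff k m i = 0 := by
  induction m with
  | zero =>
    intro i hi
    obtain ⟨j, rfl⟩ : ∃ j, i = j + 1 := ⟨i - 1, by omega⟩
    simp [betaCoeff]
  | succ m ih =>
    intro i hi
    obtain ⟨j, rfl⟩ : ∃ j, i = j + 1 := ⟨i - 1, by omega⟩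
    simp [betaCoeff, ih (j + 1) (by omega), ih j (by omega)]

theorem betaCoeff_zero (k : Type*) [Field k] (m : ℕ) : betaCoeff k m 0 = 1 := by
  induction m with
  | zero => simp [betaCoeff]
  | succ m ih => simp [betaCoeff, ih]

theorem betaCoeff_one (k : Type*) [Field k] (m : ℕ) : betaCoeff k m 1 = -(m : k) := by
  induction m with
  | zero => simp [betaCoeff]
  | succ m ih =>
    simp only [betaCoeff, betaCoeff_zero]
    rw [zero_add, ih]
    push_cast
    ring

theorem betaCoeff_two (k : Type*) [Field k] (h2 : (2 : k) ≠ 0) (m : ℕ) :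
    betaCoeff k m 2 = 3 / 4 * ((m : k) * ((m : k) - 1)) := by
  have h4 : (4 : k) ≠ 0 := by
    have : (4 : k) = 2 * 2 := by norm_num
    rw [this]
    exact mul_ne_zero h2 h2
  induction m with
  | zero => simp [betaCoeff]
  | succ m ih =>
    have h : betaCoeff k (m + 1) 2
      = betaCoeff k m 2 - (1 + ((1 : ℕ) : k) / 2) * betaCoeff k m 1 := rfl
    rw [h, ih, betaCoeff_one]
    push_cast
    field_simp
    ring

theorem pow_a_mul_b {k : Type*} [Field k] {A : Type*} [Ring A] [Algebra k A] (a b : A)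
    (hba : b * a = a * b + (1 / 2 : k) • a ^ 2) (i : ℕ) :
    a ^ i * b = b * a ^ i - ((i : k) / 2) • a ^ (i + 1) := by
  induction i with
  | zero => simp
  | succ i ih =>
    have hab : a * b = b * a - (1 / 2 : k) • a ^ 2 := by rw [hba]; abel
    calc a ^ (i + 1) * b = a ^ i * (a * b) := by rw [pow_succ, mul_assoc]
      _ = (a ^ i * b) * a - (1 / 2 : k) • a ^ (i + 2) := by
        rw [hab, mul_sub, mul_smul_comm, ← pow_add, mul_assoc]
      _ = b * a ^ (i + 1) - ((i : k) / 2) • a ^ (i + 2) - (1 / 2 : k) • a ^ (i + 2) := by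
        rw [ih, sub_mul, smul_mul_assoc, ← pow_succ, mul_assoc, ← pow_succ]
      _ = _ := by
        rw [sub_sub, ← add_smul]
        congr 2
        push_cast
        ring

theorem g_mul_pow {k : Type*} [Field k] {A : Type*} [Ring A] [Algebra k A] (g a b : A)
    (hbg : b * g = g * a + g * b)
    (hba : b * a = a * b + (1 / 2 : k) • a ^ 2) (m : ℕ) :
    g * b ^ m
      = ∑ i ∈ Finset.range (m + 1), betaCoeff k m i • (b ^ (m - i) * g * a ^ i) := by
  induction m with
  | zero => simp [betaCoeff]
  | succ m ih =>
    have hgb : g * b = b * g - g * a := by rw [hbg]; abel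
    have key : ∀ i ∈ Finset.range (m + 1),
        betaCoeff k m i • (b ^ (m - i) * g * a ^ i) * b
        = betaCoeff k m i • (b ^ (m + 1 - i) * g * a ^ i)
          - ((1 + (i : k) / 2) * betaCoeff k m i) • (b ^ (m - i) * g * a ^ (i + 1)) := by
      intro i hi
      have hi' : m + 1 - i = (m - i) + 1 := by
        have := Finset.mem_range.1 hi
        omega
      have e : b ^ (m - i) * g * a ^ i * b = b ^ (m + 1 - i) * g * a ^ i
          - (1 + (i : k) / 2) • (b ^ (m - i) * g * a ^ (i + 1)) := by
        calc b ^ (m - i) * g * a ^ i * b = b ^ (m - i) * g * (a ^ i * b) := by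
              rw [mul_assoc]
          _ = b ^ (m - i) * (g * b) * a ^ i
              - ((i : k) / 2) • (b ^ (m - i) * g * a ^ (i + 1)) := by
              rw [pow_a_mul_b a b hba, mul_sub, mul_smul_comm]
              simp only [mul_assoc]
          _ = _ := by
              rw [hgb, hi', add_smul, one_smul, pow_succ b, pow_succ' a]
              simp only [mul_sub, sub_mul, mul_assoc]
              abel
      rw [smul_mul_assoc, e, smul_sub, smul_smul, mul_comm (betaCoeff k m i)]
    rw [pow_succ, ← mul_assoc, ih, Finset.sum_mul, Finset.sum_congr rfl key,
      Finset.sum_sub_distrib]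
    have h1 : ∑ i ∈ Finset.range (m + 1), betaCoeff k m i • (b ^ (m + 1 - i) * g * a ^ i)
        = ∑ i ∈ Finset.range (m + 2), betaCoeff k m i • (b ^ (m + 1 - i) * g * a ^ i) := by
      rw [Finset.sum_range_succ _ (m + 1), betaCoeff_vanish k m (m + 1) (by omega), zero_smul,
        add_zero]
    rw [h1, Finset.sum_range_succ' _ (m + 1), Finset.sum_range_succ' _ (m + 1)]
    simp only [betaCoeff, sub_smul, Finset.sum_sub_distrib, Nat.add_sub_add_right]
    abel


/-- In char `p > 2`, with `a*g = g*a`, `b*g = g*a + g*b` and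
`b*a = a*b + (1/2)a^2`, for each `1 ≤ m ≤ p - 1` there are scalars `β_{m,i}` with
`g*b^m = ∑_{i=0}^m β_{m,i} • (b^(m-i) * g * a^i)`, `β_{m,0} = 1`,
`β_{m,1} = -m`, and (for `m ≥ 2`) `β_{m,2} = (3/4)m(m-1)`. -/
theorem stmt4 {k : Type*} [Field k] (p : ℕ) [CharP k p] (hp : 2 < p)
    {A : Type*} [Ring A] [Algebra k A] (g a b : A)
    (hag : a * g = g * a) (hbg : b * g = g * a + g * b)
    (hba : b * a = a * b + (1 / 2 : k) • a ^ 2) :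
    ∀ m : ℕ, 1 ≤ m → m ≤ p - 1 →
      ∃ β : ℕ → k,
        g * b ^ m = ∑ i ∈ Finset.range (m + 1), β i • (b ^ (m - i) * g * a ^ i) ∧
        β 0 = 1 ∧ β 1 = -(m : k) ∧
        (2 ≤ m → β 2 = 3 / 4 * ((m : k) * ((m : k) - 1))) := by
  intro m _ _
  have h2 : (2 : k) ≠ 0 := by
    intro h
    have h' : ((2 : ℕ) : k) = 0 := by exact_mod_cast h
    have := Nat.le_of_dvd (by norm_num) ((CharP.cast_eq_zero_iff k p 2).1 h')
    omega
  exact ⟨betaCoeff k m, g_mul_pow g a b hbg hba m, betaCoeff_zero k m, betaCoeff_one k m,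
    fun _ => betaCoeff_two k h2 m⟩
end

section
/- Let k be an algebraically closed field of characteristic p > 2, n = p^s·t with s ≥ 1, p ∤ t and t > 1, ξ a primitive t-th root of unity in k, and μ ∈ k. Let M be a simple left H(1,μ)-module. Then exactly one of the following holds: (i) dim_k M = 1 and g, a, b act on M as 1, 0, 0 respectively; or (ii) there exist i with 1 ≤ i ≤ t−1 and 0 ≠ v ∈ M such that g·v = ξ^i·v and a·v = (1 − ξ^i)·v, and {v, b·v, …, b^{p−1}·v} is a k-basis of M, so dim_k M = p. Moreover, two simple modules of type (ii) for distinct values of i are non-isomorphic, and no module of type (ii) is isomorphic to one of type (i). -/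
open FreeAlgebra in
/-- The defining relations of the Hopf algebra `H(λ,μ)` of Cibils–Lauve–Witherspoon, on the
free algebra on three generators `g = ι 0`, `a = ι 1`, `b = ι 2`:
`g^n = 1`, `ag = ga`, `bg = ga + gb`, `a^p = λ(1-g^p)`, `b^p = μ(1-g^p)`,
`ba = ab + (1/2)a²`. -/
inductive HRel (k : Type*) [Field k] (n p : ℕ) (lam mu : k) :
    FreeAlgebra k (Fin 3) → FreeAlgebra k (Fin 3) → Prop
  | gn : HRel k n p lam mu (ι k (0 : Fin 3) ^ n) 1
  | ag : HRel k n p lam mu (ι k (1 : Fin 3) * ι k (0 : Fin 3)) (ι k (0 : Fin 3) * ι k (1 : Fin 3))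
  | bg : HRel k n p lam mu (ι k (2 : Fin 3) * ι k (0 : Fin 3))
      (ι k (0 : Fin 3) * ι k (1 : Fin 3) + ι k (0 : Fin 3) * ι k (2 : Fin 3))
  | ap : HRel k n p lam mu (ι k (1 : Fin 3) ^ p)
      (algebraMap k (FreeAlgebra k (Fin 3)) lam * (1 - ι k (0 : Fin 3) ^ p))
  | bp : HRel k n p lam mu (ι k (2 : Fin 3) ^ p)
      (algebraMap k (FreeAlgebra k (Fin 3)) mu * (1 - ι k (0 : Fin 3) ^ p))
  | ba : HRel k n p lam mu (ι k (2 : Fin 3) * ι k (1 : Fin 3))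
      (ι k (1 : Fin 3) * ι k (2 : Fin 3)
        + algebraMap k (FreeAlgebra k (Fin 3)) (1 / 2) * ι k (1 : Fin 3) ^ 2)

/-- The algebra `H(λ,μ)`: the quotient of the free algebra on `g, a, b` by the two-sided
ideal generated by the relations `HRel`. -/
abbrev HAlg (k : Type*) [Field k] (n p : ℕ) (lam mu : k) := RingQuot (HRel k n p lam mu)

/-- The image of the generator `g` in `H(λ,μ)`. -/
noncomputable def Hg (k : Type*) [Field k] (n p : ℕ) (lam mu : k) : HAlg k n p lam mu :=
  RingQuot.mkAlgHom k (HRel k n p lam mu) (FreeAlgebra.ι k (0 : Fin 3))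

/-- The image of the generator `a` in `H(λ,μ)`. -/
noncomputable def Ha (k : Type*) [Field k] (n p : ℕ) (lam mu : k) : HAlg k n p lam mu :=
  RingQuot.mkAlgHom k (HRel k n p lam mu) (FreeAlgebra.ι k (1 : Fin 3))

/-- The image of the generator `b` in `H(λ,μ)`. -/
noncomputable def Hb (k : Type*) [Field k] (n p : ℕ) (lam mu : k) : HAlg k n p lam mu :=
  RingQuot.mkAlgHom k (HRel k n p lam mu) (FreeAlgebra.ι k (2 : Fin 3))

/-- A module is "of type (i)": one-dimensional over `k`, with `g` acting as the identity
and `a`, `b` acting as zero. -/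
def TypeOne (k : Type*) [Field k] (n p : ℕ) (mu : k)
    (M : Type) [AddCommGroup M] [Module k M] [Module (HAlg k n p 1 mu) M] : Prop :=
  Module.rank k M = 1 ∧
    ∀ m : M, Hg k n p 1 mu • m = m ∧ Ha k n p 1 mu • m = 0 ∧ Hb k n p 1 mu • m = 0

/-- A module is "of type (ii) at `i`": it contains `v ≠ 0` with `g•v = ξ^i•v`,
`a•v = (1-ξ^i)•v`, such that `v, b•v, …, b^(p-1)•v` is a `k`-basis. -/
def TypeTwoAt (k : Type*) [Field k] (n p : ℕ) (mu ξ : k)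
    (M : Type) [AddCommGroup M] [Module k M] [Module (HAlg k n p 1 mu) M]
    (i : ℕ) : Prop :=
  ∃ v : M, v ≠ 0 ∧
    Hg k n p 1 mu • v = ξ ^ i • v ∧ Ha k n p 1 mu • v = (1 - ξ ^ i) • v ∧
    LinearIndependent k (fun l : Fin p => (Hb k n p 1 mu ^ (l : ℕ)) • v) ∧
    Submodule.span k (Set.range fun l : Fin p => (Hb k n p 1 mu ^ (l : ℕ)) • v) = ⊤

open Polynomial in
theorem aux_eig {k M : Type*} [Field k] [AddCommGroup M] [Module k M] (G : Module.End k M)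
    (S : Multiset k) : ∀ v : M, v ≠ 0 → aeval G ((S.map fun r => X - C r).prod) v = 0 →
    ∃ r : k, ∃ w : M, w ≠ 0 ∧ G w = r • w := by
  induction S using Multiset.induction_on with
  | empty => intro v hv h; simp at h; exact absurd h hv
  | cons r S ih =>
    intro v hv h
    rw [Multiset.map_cons, Multiset.prod_cons, mul_comm, map_mul, Module.End.mul_apply] at h
    by_cases h0 : aeval G (X - C r) v = 0
    · refine ⟨r, v, hv, ?_⟩
      simpa [sub_eq_zero, Module.algebraMap_end_apply] using h0
    · exact ih _ h0 h

theorem aux_nil {k M : Type*} [Field k] [AddCommGroup M] [Module k M] (f : Module.End k M)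
    (E : M → Prop) (hE : ∀ x, E x → E (f x)) (N : ℕ) :
    ∀ v : M, E v → v ≠ 0 → (f ^ N) v = 0 → ∃ w, E w ∧ w ≠ 0 ∧ f w = 0 := by
  induction N with
  | zero => intro v _ hv h; simp at h; exact absurd h hv
  | succ N ih =>
    intro v hEv hv h
    by_cases h0 : f v = 0
    · exact ⟨v, hEv, hv, h0⟩
    · refine ih (f v) (hE v hEv) h0 ?_
      rw [pow_succ, Module.End.mul_apply] at h
      exact h

open Polynomial in
theorem aux_frob {k M : Type*} [Field k] [AddCommGroup M] [Module k M] (p : ℕ) [CharP k p]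
    [Fact p.Prime] (A : Module.End k M) (c : k) (v : M) :
    ((A - algebraMap k _ c) ^ p) v = (A ^ p) v - c ^ p • v := by
  have h : (X - C c : k[X]) ^ p = X ^ p - C (c ^ p) := by
    rw [sub_pow_char, C_pow]
  have h2 := congrArg (fun q => aeval A q v) h
  simp only [map_pow, map_sub, aeval_X, aeval_C, LinearMap.sub_apply] at h2
  rw [h2, ← map_pow, Module.algebraMap_end_apply]

/-- The span of the first `l` vectors `v, Bv, …`. -/
def auxS {k M : Type*} [Field k] [AddCommGroup M] [Module k M] (B : Module.End k M) (v : M)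
    (l : ℕ) : Submodule k M := Submodule.span k ((fun j => (B ^ j) v) '' Set.Iio l)

section
variable {k M : Type*} [Field k] [AddCommGroup M] [Module k M] (A B G : Module.End k M) (v : M)

theorem auxS_mem {j l : ℕ} (h : j < l) : (B ^ j) v ∈ auxS B v l :=
  Submodule.subset_span ⟨j, h, rfl⟩

theorem auxS_mono {j l : ℕ} (h : j ≤ l) : auxS B v j ≤ auxS B v l :=
  Submodule.span_mono (Set.image_mono (Set.Iio_subset_Iio h))

theorem auxS_le {l : ℕ} {W : Submodule k M} (h : ∀ j < l, (B ^ j) v ∈ W) : auxS B v l ≤ W := by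
  refine Submodule.span_le.2 ?_
  rintro _ ⟨j, hj, rfl⟩
  exact h j hj

theorem auxS_B {l : ℕ} {x : M} (hx : x ∈ auxS B v l) : B x ∈ auxS B v (l + 1) := by
  have : auxS B v l ≤ (auxS B v (l + 1)).comap B := by
    refine auxS_le B v fun j hj => ?_
    rw [Submodule.mem_comap, ← Module.End.mul_apply, ← pow_succ']
    exact auxS_mem B v (by omega)
  exact this hx

/-- leading terms of `A B^l v` -/
theorem aux_lead (α : k) (hA : A v = α • v)
    (hBA : ∀ x, A (B x) = B (A x) - (1 / 2 : k) • A (A x)) (l : ℕ) :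
    (∀ j < l, (A ((B ^ j) v) - α • (B ^ j) v) ∈ auxS B v j) ∧
    (A ((B ^ l) v) - α • (B ^ l) v) ∈ auxS B v l ∧
    (A ((B ^ (l + 1)) v) - α • (B ^ (l + 1)) v + (((l : k) + 1) / 2 * α ^ 2) • (B ^ l) v)
      ∈ auxS B v l := by
  induction l with
  | zero =>
    refine ⟨by simp, by simp [hA], ?_⟩
    have : A ((B ^ (0 + 1)) v) - α • (B ^ (0 + 1)) v + ((((0 : ℕ) : k) + 1) / 2 * α ^ 2) • (B ^ 0) v
        = 0 := by
      simp [hBA, hA]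
      module
    rw [this]; exact zero_mem _
  | succ l ih =>
    obtain ⟨h1, h2, h3⟩ := ih
    have h1' : ∀ j < l + 1, (A ((B ^ j) v) - α • (B ^ j) v) ∈ auxS B v j := by
      intro j hj
      rcases Nat.lt_succ_iff_lt_or_eq.1 hj with h | rfl
      · exact h1 j h
      · exact h2
    have h2' : A ((B ^ (l + 1)) v) - α • (B ^ (l + 1)) v ∈ auxS B v (l + 1) := by
      have e := Submodule.sub_mem _ (auxS_mono B v (Nat.le_succ l) h3)
        (Submodule.smul_mem _ (((l : k) + 1) / 2 * α ^ 2) (auxS_mem B v (Nat.lt_succ_self l)))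
      simpa using e
    refine ⟨h1', h2', ?_⟩
    have hst : ∀ x ∈ auxS B v (l + 1), A x ∈ auxS B v (l + 1) := by
      have : auxS B v (l + 1) ≤ (auxS B v (l + 1)).comap A := by
        refine auxS_le B v fun j hj => ?_
        have e := Submodule.add_mem _ (auxS_mono B v hj.le (h1' j hj))
          (Submodule.smul_mem _ α (auxS_mem B v hj))
        simpa using e
      exact fun x hx => this hx
    have e1 := auxS_B B v h3
    have e2 := hst _ h2'
    have e3 := Submodule.add_mem _ (Submodule.sub_mem _ e1 (Submodule.smul_mem _ (1 / 2 : k) e2))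
      (Submodule.smul_mem _ (-(1 / 2 : k) * α) h2')
    convert e3 using 1
    have p1 : (B ^ (l + 1 + 1)) v = B ((B ^ (l + 1)) v) := by
      rw [pow_succ', Module.End.mul_apply]
    have p2 : (B ^ (l + 1)) v = B ((B ^ l) v) := by
      rw [pow_succ', Module.End.mul_apply]
    rw [p1, hBA]
    simp only [map_add, map_sub, map_smul, ← p2]
    push_cast
    module

theorem aux_stable (α : k) (hA : A v = α • v)
    (hBA : ∀ x, A (B x) = B (A x) - (1 / 2 : k) • A (A x)) (l : ℕ) :
    ∀ x ∈ auxS B v l, A x ∈ auxS B v l := by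
  have : auxS B v l ≤ (auxS B v l).comap A := by
    refine auxS_le B v fun j hj => ?_
    have e := Submodule.add_mem _ (auxS_mono B v hj.le ((aux_lead A B v α hA hBA l).1 j hj))
      (Submodule.smul_mem _ α (auxS_mem B v hj))
    simpa using e
  exact fun x hx => this hx

theorem aux_stableG (α β : k) (hA : A v = α • v) (hG : G v = β • v)
    (hBA : ∀ x, A (B x) = B (A x) - (1 / 2 : k) • A (A x))
    (hAG : ∀ x, A (G x) = G (A x))
    (hBG : ∀ x, G (B x) = B (G x) - A (G x)) (l : ℕ) :
    ∀ x ∈ auxS B v l, G x ∈ auxS B v l := by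
  induction l with
  | zero =>
    intro x hx
    have : x = 0 := by simpa [auxS] using hx
    simp [this]
  | succ l ih =>
    have : auxS B v (l + 1) ≤ (auxS B v (l + 1)).comap G := by
      refine auxS_le B v fun j hj => ?_
      rw [Submodule.mem_comap]
      rcases j with _ | j
      · simp only [pow_zero, Module.End.one_apply, hG]
        exact Submodule.smul_mem _ _ (auxS_mem (j := 0) B v hj)
      · rw [pow_succ', Module.End.mul_apply, hBG]
        have h1 := ih _ (auxS_mem B v (show j < l by omega))
        exact Submodule.sub_mem _ (auxS_B B v h1)
          (auxS_mono B v (Nat.le_succ l) (aux_stable A B v α hA hBA l _ h1))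
    exact fun x hx => this hx

theorem aux_notmem (p : ℕ) [CharP k p] (hp : 2 < p) (hv : v ≠ 0)
    (α : k) (hα : α ≠ 0) (hA : A v = α • v)
    (hBA : ∀ x, A (B x) = B (A x) - (1 / 2 : k) • A (A x)) (l : ℕ) (hl : l < p) :
    (B ^ l) v ∉ auxS B v l := by
  induction l with
  | zero => simpa [auxS] using hv
  | succ l ih =>
    intro h
    refine ih (by omega) ?_
    have hst : ∀ x ∈ auxS B v (l + 1), A x - α • x ∈ auxS B v l := by
      have : auxS B v (l + 1) ≤ (auxS B v l).comap (A - algebraMap k _ α) := by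
        refine auxS_le B v fun j hj => ?_
        have e := auxS_mono B v (Nat.le_of_lt_succ hj) ((aux_lead A B v α hA hBA (l + 1)).1 j hj)
        simpa [Module.algebraMap_end_apply] using e
      intro x hx
      simpa [Module.algebraMap_end_apply] using this hx
    have h1 := hst _ h
    have h2 := Submodule.sub_mem _ (aux_lead A B v α hA hBA l).2.2 h1
    rw [add_sub_cancel_left] at h2
    refine (Submodule.smul_mem_iff _ ?_).1 h2
    have c1 : ((l : k) + 1) ≠ 0 := by
      have : ((l + 1 : ℕ) : k) ≠ 0 := by
        rw [Ne, CharP.cast_eq_zero_iff k p]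
        exact fun hd => absurd (Nat.le_of_dvd (by omega) hd) (by omega)
      simpa using this
    have c2 : (2 : k) ≠ 0 := by
      have : ((2 : ℕ) : k) ≠ 0 := by
        rw [Ne, CharP.cast_eq_zero_iff k p]
        exact fun hd => absurd (Nat.le_of_dvd (by omega) hd) (by omega)
      simpa using this
    exact mul_ne_zero (div_ne_zero c1 c2) (pow_ne_zero _ hα)

theorem auxS_range (l : ℕ) :
    Submodule.span k (Set.range fun j : Fin l => (B ^ (j : ℕ)) v) = auxS B v l := by
  unfold auxS
  congr 1
  ext x
  constructor
  · rintro ⟨j, rfl⟩; exact ⟨j, j.2, rfl⟩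
  · rintro ⟨j, hj, rfl⟩; exact ⟨⟨j, hj⟩, rfl⟩

theorem aux_indep (p : ℕ) (h : ∀ l < p, (B ^ l) v ∉ auxS B v l) :
    LinearIndependent k (fun j : Fin p => (B ^ (j : ℕ)) v) := by
  induction p with
  | zero => exact linearIndependent_empty_type
  | succ p ih =>
    rw [linearIndependent_finSucc']
    refine ⟨ih fun l hl => h l (by omega), ?_⟩
    have := h p (by omega)
    rw [← auxS_range] at this
    exact this

end

/-- a `k`-subspace stable under the generators of a simple module is everything -/
theorem aux_top {k : Type*} [Field k] (n p : ℕ) (mu : k) (M : Type) [AddCommGroup M] [Module k M]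
    [Module (HAlg k n p 1 mu) M] [IsScalarTower k (HAlg k n p 1 mu) M]
    (hM : IsSimpleModule (HAlg k n p 1 mu) M) (W : Submodule k M)
    (hg : ∀ x ∈ W, Hg k n p 1 mu • x ∈ W) (ha : ∀ x ∈ W, Ha k n p 1 mu • x ∈ W)
    (hb : ∀ x ∈ W, Hb k n p 1 mu • x ∈ W) (v : M) (hv : v ≠ 0) (hvW : v ∈ W) : W = ⊤ := by
  have key : ∀ y : FreeAlgebra k (Fin 3), ∀ x ∈ W,
      RingQuot.mkAlgHom k (HRel k n p 1 mu) y • x ∈ W := by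
    intro y
    induction y using FreeAlgebra.induction with
    | grade0 r =>
      intro x hx
      rw [AlgHom.commutes, algebraMap_smul]
      exact W.smul_mem _ hx
    | grade1 i =>
      fin_cases i
      · exact hg
      · exact ha
      · exact hb
    | mul a b iha ihb =>
      intro x hx
      rw [map_mul, mul_smul]
      exact iha _ (ihb _ hx)
    | add a b iha ihb =>
      intro x hx
      rw [map_add, add_smul]
      exact W.add_mem (iha _ hx) (ihb _ hx)
  let W' : Submodule (HAlg k n p 1 mu) M :=
    { carrier := W
      add_mem' := fun h1 h2 => W.add_mem h1 h2
      zero_mem' := W.zero_mem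
      smul_mem' := by
        intro c x hx
        obtain ⟨y, rfl⟩ := RingQuot.mkAlgHom_surjective k (HRel k n p 1 mu) c
        exact key y x hx }
  have hW' : W' = ⊤ := by
    refine (eq_bot_or_eq_top W').resolve_left fun h => hv ?_
    have : v ∈ W' := hvW
    rw [h] at this
    simpa using this
  refine eq_top_iff.2 fun x _ => ?_
  have : x ∈ W' := by rw [hW']; trivial
  exact this

section
variable {k : Type*} [Field k] (n p : ℕ) (lam mu : k)

theorem Hrel_gn : Hg k n p lam mu ^ n = 1 := by
  have := RingQuot.mkAlgHom_rel k (HRel.gn (k := k) (n := n) (p := p) (lam := lam) (mu := mu))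
  simpa [Hg] using this

theorem Hrel_ag : Ha k n p lam mu * Hg k n p lam mu = Hg k n p lam mu * Ha k n p lam mu := by
  have := RingQuot.mkAlgHom_rel k (HRel.ag (k := k) (n := n) (p := p) (lam := lam) (mu := mu))
  simpa [Hg, Ha] using this

theorem Hrel_bg : Hb k n p lam mu * Hg k n p lam mu
    = Hg k n p lam mu * Ha k n p lam mu + Hg k n p lam mu * Hb k n p lam mu := by
  have := RingQuot.mkAlgHom_rel k (HRel.bg (k := k) (n := n) (p := p) (lam := lam) (mu := mu))
  simpa [Hg, Ha, Hb] using this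

theorem Hrel_ap : Ha k n p lam mu ^ p
    = algebraMap k _ lam * (1 - Hg k n p lam mu ^ p) := by
  have := RingQuot.mkAlgHom_rel k (HRel.ap (k := k) (n := n) (p := p) (lam := lam) (mu := mu))
  simpa only [Hg, Ha, map_pow, map_mul, map_sub, map_one, AlgHom.commutes] using this

theorem Hrel_bp : Hb k n p lam mu ^ p
    = algebraMap k _ mu * (1 - Hg k n p lam mu ^ p) := by
  have := RingQuot.mkAlgHom_rel k (HRel.bp (k := k) (n := n) (p := p) (lam := lam) (mu := mu))
  simpa only [Hg, Hb, map_pow, map_mul, map_sub, map_one, AlgHom.commutes] using this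

theorem Hrel_ba : Hb k n p lam mu * Ha k n p lam mu
    = Ha k n p lam mu * Hb k n p lam mu + algebraMap k _ (1 / 2) * Ha k n p lam mu ^ 2 := by
  have := RingQuot.mkAlgHom_rel k (HRel.ba (k := k) (n := n) (p := p) (lam := lam) (mu := mu))
  simpa only [Ha, Hb, map_pow, map_mul, map_add, AlgHom.commutes] using this

theorem Hrel_gpb [CharP k p] : ∀ m : ℕ, Hb k n p lam mu * Hg k n p lam mu ^ m
    = Hg k n p lam mu ^ m * (Hb k n p lam mu + algebraMap k _ (m : k) * Ha k n p lam mu) := by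
  intro m
  induction m with
  | zero => simp
  | succ m ih =>
    have hc : algebraMap k (HAlg k n p lam mu) (m : k) * Ha k n p lam mu * Hg k n p lam mu
       = Hg k n p lam mu * (algebraMap k (HAlg k n p lam mu) (m : k) * Ha k n p lam mu) := by
      rw [mul_assoc, Hrel_ag, ← mul_assoc, Algebra.commutes, mul_assoc]
    rw [pow_succ, ← mul_assoc, ih, mul_assoc, add_mul, Hrel_bg, hc, mul_assoc,
      ← mul_add, ← mul_add]
    congr 2
    push_cast
    noncomm_ring
end

/-- the scalar by which `g ^ p` acts on a type two module -/
theorem aux_gp {k : Type*} [Field k] (n p : ℕ) [CharP k p] (mu ξ : k) (M : Type)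
    [AddCommGroup M] [Module k M]
    [Module (HAlg k n p 1 mu) M] [IsScalarTower k (HAlg k n p 1 mu) M] (i : ℕ)
    (h : TypeTwoAt k n p mu ξ M i) (x : M) :
    Hg k n p 1 mu ^ p • x = (ξ ^ i) ^ p • x := by
  obtain ⟨v, hv, hg, ha, -, hspan⟩ := h
  have hcomm : ∀ y : M, Hg k n p 1 mu ^ p • Hb k n p 1 mu • y
      = Hb k n p 1 mu • Hg k n p 1 mu ^ p • y := by
    intro y
    rw [← mul_smul, ← mul_smul, Hrel_gpb]
    simp
  have hgm : ∀ m : ℕ, Hg k n p 1 mu ^ m • v = (ξ ^ i) ^ m • v := by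
    intro m
    induction m with
    | zero => simp
    | succ m ih => rw [pow_succ, mul_smul, hg, smul_comm, ih, smul_smul, pow_succ']
  have hl : ∀ l : ℕ, Hg k n p 1 mu ^ p • (Hb k n p 1 mu ^ l • v)
      = (ξ ^ i) ^ p • (Hb k n p 1 mu ^ l • v) := by
    intro l
    induction l with
    | zero => simpa using hgm p
    | succ l ih => rw [pow_succ', mul_smul, hcomm, ih, smul_comm]
  have hx : x ∈ Submodule.span k (Set.range fun l : Fin p => (Hb k n p 1 mu ^ (l : ℕ)) • v) := by
    rw [hspan]; trivial
  induction hx using Submodule.span_induction with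
  | mem x hx => obtain ⟨l, rfl⟩ := hx; exact hl l
  | zero => simp
  | add x y _ _ hx hy => rw [smul_add, hx, hy, smul_add]
  | smul c x _ hx => rw [smul_comm, hx, smul_comm]

open Polynomial in
theorem aux_exists {k : Type*} [Field k] [IsAlgClosed k] (p : ℕ) [CharP k p] (hp : 2 < p)
    (n s t : ℕ) (hn : n = p ^ s * t) (ht : 1 < t)
    (ξ : k) (hξ : IsPrimitiveRoot ξ t) (mu : k)
    (M : Type) [AddCommGroup M] [Module k M]
    [Module (HAlg k n p 1 mu) M]
    [IsScalarTower k (HAlg k n p 1 mu) M]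
    (hM : IsSimpleModule (HAlg k n p 1 mu) M) :
    (TypeOne k n p mu M) ∨
      (∃ i : ℕ, 1 ≤ i ∧ i ≤ t - 1 ∧ TypeTwoAt k n p mu ξ M i ∧
        Module.rank k M = p) := by
  have hpp : p.Prime := (CharP.char_is_prime_or_zero k p).resolve_right (by omega)
  haveI : Fact p.Prime := ⟨hpp⟩
  have hn0 : n ≠ 0 := hn ▸ mul_ne_zero (pow_ne_zero _ hpp.ne_zero) (by omega)
  set φ := Algebra.lsmul k k M (A := HAlg k n p 1 mu) with hφ
  set G := φ (Hg k n p 1 mu) with hGdef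
  set A := φ (Ha k n p 1 mu) with hAdef
  set B := φ (Hb k n p 1 mu) with hBdef
  have rgn : G ^ n = 1 := by rw [hGdef, ← map_pow, Hrel_gn, map_one]
  have rag : A * G = G * A := by rw [hGdef, hAdef, ← map_mul, Hrel_ag, map_mul]
  have rbg : B * G = G * A + G * B := by
    rw [hGdef, hAdef, hBdef, ← map_mul, Hrel_bg, map_add, map_mul, map_mul]
  have rap : A ^ p = 1 - G ^ p := by
    rw [hGdef, hAdef, ← map_pow, Hrel_ap]; simp
  have rbp : B ^ p = algebraMap k _ mu * (1 - G ^ p) := by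
    rw [hGdef, hBdef, ← map_pow, Hrel_bp, map_mul, AlgHom.commutes]; simp
  have rba : B * A = A * B + algebraMap k _ (1 / 2) * A ^ 2 := by
    rw [hBdef, hAdef, ← map_mul, Hrel_ba, map_add, map_mul, map_mul, AlgHom.commutes, map_pow]
  have rag' : ∀ x, A (G x) = G (A x) := fun x => LinearMap.congr_fun rag x
  have rbg' : ∀ x, G (B x) = B (G x) - A (G x) := by
    intro x
    have := LinearMap.congr_fun rbg x
    simp only [Module.End.mul_apply, LinearMap.add_apply] at this
    rw [this, rag']; abel
  have rba' : ∀ x, A (B x) = B (A x) - (1 / 2 : k) • A (A x) := by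
    intro x
    have := LinearMap.congr_fun rba x
    simp only [Module.End.mul_apply, LinearMap.add_apply, pow_two,
      Module.algebraMap_end_apply] at this
    rw [this]; abel
  -- eigenvector of G
  haveI := hM.nontrivial
  obtain ⟨u, hu⟩ := exists_ne (0 : M)
  obtain ⟨ζ, w, hw, hGw⟩ : ∃ r : k, ∃ w : M, w ≠ 0 ∧ G w = r • w := by
    have hsp := IsAlgClosed.splits (X ^ n - 1 : k[X])
    have hmon : (X ^ n - 1 : k[X]).Monic := monic_X_pow_sub_C (1 : k) hn0
    refine aux_eig G (X ^ n - 1 : k[X]).roots u hu ?_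
    rw [← hsp.eq_prod_roots_of_monic hmon]
    simp [rgn]
  have hGpow : ∀ (x : M), G x = ζ • x → ∀ m : ℕ, (G ^ m) x = ζ ^ m • x := by
    intro x hx m
    induction m with
    | zero => simp
    | succ m ih => rw [pow_succ, Module.End.mul_apply, hx, map_smul, ih, smul_smul, pow_succ']
  have hζn : ζ ^ n = 1 := by
    have h1 := hGpow w hGw n
    rw [rgn, Module.End.one_apply] at h1
    have h2 : (ζ ^ n - 1) • w = 0 := by rw [sub_smul, ← h1, one_smul, sub_self]
    exact sub_eq_zero.1 ((smul_eq_zero.1 h2).resolve_right hw)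
  have hζt : ζ ^ t = 1 := by
    have h1 : (ζ ^ t - 1) ^ (p ^ s) = 0 := by
      rw [sub_pow_char_pow, ← pow_mul, mul_comm, ← hn, hζn, one_pow, sub_self]
    exact sub_eq_zero.1 (eq_zero_of_pow_eq_zero h1)
  haveI : NeZero t := ⟨by omega⟩
  obtain ⟨i, hit, hi⟩ := hξ.eq_pow_of_pow_eq_one hζt
  -- common eigenvector
  obtain ⟨v, hGv, hv, hAv⟩ := aux_nil (A - algebraMap k _ (1 - ζ)) (fun x => G x = ζ • x)
    (by
      intro x hx
      simp only [LinearMap.sub_apply, Module.algebraMap_end_apply, map_sub, map_smul, ← rag', hx]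
      module) p w hGw hw
    (by
      rw [aux_frob, rap, LinearMap.sub_apply, Module.End.one_apply, hGpow w hGw,
        sub_pow_char, one_pow]
      module)
  have hAv : A v = (1 - ζ) • v := by
    rw [LinearMap.sub_apply, Module.algebraMap_end_apply] at hAv
    exact sub_eq_zero.1 hAv
  by_cases hi0 : i = 0
  · left
    have hζ1 : ζ = 1 := by rw [← hi, hi0, pow_zero]
    subst hζ1
    obtain ⟨w, ⟨hw1, hw2⟩, hw0, hw3⟩ := aux_nil B (fun x => G x = x ∧ A x = 0)
      (by
        rintro x ⟨h1, h2⟩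
        simp [rbg', rba', h1, h2]) p v ⟨by simpa using hGv, by simpa using hAv⟩ hv
      (by
        rw [rbp, Module.End.mul_apply, LinearMap.sub_apply, hGpow v hGv]
        simp)
    have htop : Submodule.span k {w} = ⊤ := by
      refine aux_top n p mu M hM _ ?_ ?_ ?_ w hw0 (Submodule.mem_span_singleton_self w)
      · intro x hx
        obtain ⟨c, rfl⟩ := Submodule.mem_span_singleton.1 hx
        change G (c • w) ∈ _
        rw [map_smul, hw1]; exact hx
      · intro x hx
        obtain ⟨c, rfl⟩ := Submodule.mem_span_singleton.1 hx
        change A (c • w) ∈ _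
        rw [map_smul, hw2]; simp
      · intro x hx
        obtain ⟨c, rfl⟩ := Submodule.mem_span_singleton.1 hx
        change B (c • w) ∈ _
        rw [map_smul, hw3]; simp
    have hall : ∀ x : M, ∃ c : k, c • w = x := fun x =>
      Submodule.mem_span_singleton.1 (by rw [htop]; trivial)
    refine ⟨?_, ?_⟩
    · exact rank_eq_one w hw0 hall
    · intro x
      obtain ⟨c, rfl⟩ := hall x
      refine ⟨?_, ?_, ?_⟩
      · change G (c • w) = _
        rw [map_smul, hw1]
      · change A (c • w) = _
        rw [map_smul, hw2, smul_zero]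
      · change B (c • w) = _
        rw [map_smul, hw3, smul_zero]
  · right
    have hζ1 : 1 - ζ ≠ 0 := by
      intro h
      exact hξ.pow_ne_one_of_pos_of_lt hi0 hit (by rw [hi]; exact (sub_eq_zero.1 h).symm)
    have hli := aux_indep B v p (aux_notmem A B v p hp hv (1 - ζ) hζ1 hAv rba')
    have htop : auxS B v p = ⊤ := by
      refine aux_top n p mu M hM _ ?_ ?_ ?_ v hv
        (by simpa using auxS_mem (j := 0) B v hpp.pos)
      · exact aux_stableG A B G v _ _ hAv hGv rba' rag' rbg' p
      · exact aux_stable A B v _ hAv rba' p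
      · have : auxS B v p ≤ (auxS B v p).comap B := by
          refine auxS_le B v fun j hj => ?_
          rw [Submodule.mem_comap, ← Module.End.mul_apply, ← pow_succ']
          rcases Nat.lt_or_ge (j + 1) p with h | h
          · exact auxS_mem B v h
          · have hj : j + 1 = p := by omega
            rw [hj, rbp, Module.End.mul_apply, LinearMap.sub_apply, hGpow v hGv,
              Module.End.one_apply, Module.algebraMap_end_apply]
            have hvm : v ∈ auxS B v p := by simpa using auxS_mem (j := 0) B v hpp.pos
            exact Submodule.smul_mem _ _ (Submodule.sub_mem _ hvm (Submodule.smul_mem _ _ hvm))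
        exact fun x hx => this hx
    rw [← auxS_range] at htop
    have hfun : (fun l : Fin p => (Hb k n p 1 mu ^ (l : ℕ)) • v)
        = fun l : Fin p => (B ^ (l : ℕ)) v := by
      funext l
      rw [hBdef, ← map_pow]
      rfl
    refine ⟨i, by omega, by omega, ⟨v, hv, ?_, ?_, ?_, ?_⟩, ?_⟩
    · rw [hi]; exact hGv
    · rw [hi]; exact hAv
    · rw [hfun]; exact hli
    · rw [hfun]; exact htop
    · rw [rank_eq_card_basis (Module.Basis.mk hli htop.ge), Fintype.card_fin]

theorem aux_one_two {k : Type*} [Field k] (n p t : ℕ) (mu ξ : k) (hξ : IsPrimitiveRoot ξ t)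
    (M M' : Type) [AddCommGroup M] [Module k M] [Module (HAlg k n p 1 mu) M]
    [IsScalarTower k (HAlg k n p 1 mu) M]
    [AddCommGroup M'] [Module k M'] [Module (HAlg k n p 1 mu) M'] (i : ℕ) (h1 : 1 ≤ i)
    (h2 : i ≤ t - 1) (hT : TypeTwoAt k n p mu ξ M i) (hO : TypeOne k n p mu M')
    (e : M ≃ₗ[HAlg k n p 1 mu] M') : False := by
  obtain ⟨v, hv, hg, -⟩ := hT
  have h : Hg k n p 1 mu • v = v := by
    apply e.injective
    rw [map_smul, (hO.2 (e v)).1]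
  rw [h] at hg
  have h3 : (ξ ^ i - 1) • v = 0 := by rw [sub_smul, ← hg, one_smul, sub_self]
  exact hξ.pow_ne_one_of_pos_of_lt (by omega) (by omega)
    (sub_eq_zero.1 ((smul_eq_zero.1 h3).resolve_right hv))

/-- For `k` algebraically closed of characteristic `p > 2`,
`n = p^s·t` with `s ≥ 1`, `p ∤ t`, `t > 1`, and `ξ` a primitive `t`-th root of unity:
every simple left `H(1,μ)`-module `M` is either of type (i), or of type (ii) at some
`1 ≤ i ≤ t-1` with `dim_k M = p` — and exactly one of these holds. Moreover, simple
modules of type (ii) at distinct indices are non-isomorphic, and no simple module of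
type (ii) is isomorphic to one of type (i). -/
theorem stmt14 {k : Type*} [Field k] [IsAlgClosed k] (p : ℕ) [CharP k p] (hp : 2 < p)
    (s t : ℕ) (hs : 1 ≤ s) (ht : 1 < t) (hpt : ¬ p ∣ t)
    (ξ : k) (hξ : IsPrimitiveRoot ξ t) (mu : k)
    (M : Type) [AddCommGroup M] [Module k M]
    [Module (HAlg k (p ^ s * t) p 1 mu) M]
    [IsScalarTower k (HAlg k (p ^ s * t) p 1 mu) M]
    (hM : IsSimpleModule (HAlg k (p ^ s * t) p 1 mu) M) :
    Xor' (TypeOne k (p ^ s * t) p mu M)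
      (∃ i : ℕ, 1 ≤ i ∧ i ≤ t - 1 ∧ TypeTwoAt k (p ^ s * t) p mu ξ M i ∧
        Module.rank k M = p) ∧
    (∀ (M' : Type) [AddCommGroup M'] [Module k M']
        [Module (HAlg k (p ^ s * t) p 1 mu) M']
        [IsScalarTower k (HAlg k (p ^ s * t) p 1 mu) M'],
      IsSimpleModule (HAlg k (p ^ s * t) p 1 mu) M' →
        (∀ i i' : ℕ, 1 ≤ i → i ≤ t - 1 → 1 ≤ i' → i' ≤ t - 1 →
          TypeTwoAt k (p ^ s * t) p mu ξ M i → TypeTwoAt k (p ^ s * t) p mu ξ M' i' →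
          Nonempty (M ≃ₗ[HAlg k (p ^ s * t) p 1 mu] M') → i = i') ∧
        (∀ i : ℕ, 1 ≤ i → i ≤ t - 1 → TypeTwoAt k (p ^ s * t) p mu ξ M i →
          TypeOne k (p ^ s * t) p mu M' →
          ¬ Nonempty (M ≃ₗ[HAlg k (p ^ s * t) p 1 mu] M'))) := by
  have hpp : p.Prime := (CharP.char_is_prime_or_zero k p).resolve_right (by omega)
  haveI : Fact p.Prime := ⟨hpp⟩
  refine ⟨?_, ?_⟩
  · rcases aux_exists p hp _ s t rfl ht ξ hξ mu M hM with h | h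
    · refine Or.inl ⟨h, ?_⟩
      rintro ⟨i, h1, h2, h3, -⟩
      exact aux_one_two _ p t mu ξ hξ M M i h1 h2 h3 h (LinearEquiv.refl _ _)
    · refine Or.inr ⟨h, ?_⟩
      intro h'
      obtain ⟨i, h1, h2, h3, -⟩ := h
      exact aux_one_two _ p t mu ξ hξ M M i h1 h2 h3 h' (LinearEquiv.refl _ _)
  · intro M' _ _ _ _ hM'
    refine ⟨?_, ?_⟩
    · rintro i i' h1 h2 h1' h2' hT hT' ⟨e⟩
      have hT0 := hT
      obtain ⟨v, hv, hg, -⟩ := hT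
      have e1 := aux_gp _ p mu ξ M i hT0 v
      have e2 := aux_gp _ p mu ξ M' i' hT' (e v)
      have e3 := congrArg e e1
      rw [map_smul, e2, ← algebraMap_smul (HAlg k (p ^ s * t) p 1 mu) ((ξ ^ i) ^ p) v,
        map_smul, algebraMap_smul] at e3
      have hev : e v ≠ 0 := by simpa using hv
      have e4 := smul_left_injective k hev e3
      have e5 : (ξ ^ i' - ξ ^ i) ^ p = 0 := by rw [sub_pow_char, e4, sub_self]
      have e6 := sub_eq_zero.1 (eq_zero_of_pow_eq_zero e5)
      exact (hξ.pow_inj (by omega) (by omega) e6).symm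
    · rintro i h1 h2 hT hO ⟨e⟩
      exact aux_one_two _ p t mu ξ hξ M M' i h1 h2 hT hO e
end
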